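/- arXiv:2002.09191 — 4 statements merged into one kernel-verified Lean document; each statement's English description precedes it below -/
import Mathlib

section
/- Depth-1 two-class S-ORCT (Theorem 1 instance): assume the depth-1 two-class ORCT setup with F : ℝ → ℝ continuous, and let λ ≥ 0. Then there exists a* : Fin p → ℝ with a*_j ∈ [−1,1] for all j, μ* ∈ [−1,1], and a feasible binary C*, such that g(a*, μ*, C*) + λ·∑_j |a*_j| ≤ g(a, μ, C) + λ·∑_j |a_j| for every a : Fin p → ℝ with a_j ∈ [−1,1] for all j, every μ ∈ [−1,1], and every feasible C. That is, the depth-1 S-ORCT problem admits an optimal solution whose class-assignment variables are all 0 or 1. -/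
open Finset

/-- Expected misclassification cost of the depth-1 two-class ORCT. -/
noncomputable def g (p N : ℕ) (x : Fin N → Fin p → ℝ) (I₁ I₂ : Finset (Fin N))
    (W12 W21 : ℝ) (F : ℝ → ℝ) (a : Fin p → ℝ) (μ : ℝ)
    (C12 C13 C22 C23 : ℝ) : ℝ :=
  (1 / (N : ℝ)) *
    ((∑ i ∈ I₁, (F ((1 / (p : ℝ)) * (∑ j, a j * x i j) - μ) * W12 * C22
        + (1 - F ((1 / (p : ℝ)) * (∑ j, a j * x i j) - μ)) * W12 * C23))
      + (∑ i ∈ I₂, (F ((1 / (p : ℝ)) * (∑ j, a j * x i j) - μ) * W21 * C12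
        + (1 - F ((1 / (p : ℝ)) * (∑ j, a j * x i j) - μ)) * W21 * C13)))

/-- Feasibility of the class-assignment variables for two classes and two leaves. -/
def FeasibleC (C12 C13 C22 C23 : ℝ) : Prop :=
  C12 ∈ Set.Icc (0 : ℝ) 1 ∧ C13 ∈ Set.Icc (0 : ℝ) 1 ∧
  C22 ∈ Set.Icc (0 : ℝ) 1 ∧ C23 ∈ Set.Icc (0 : ℝ) 1 ∧
  C12 + C22 = 1 ∧ C13 + C23 = 1 ∧ 1 ≤ C12 + C13 ∧ 1 ≤ C22 + C23

/-- Binary class-assignment variables. -/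
def BinaryC (C12 C13 C22 C23 : ℝ) : Prop :=
  (C12 = 0 ∨ C12 = 1) ∧ (C13 = 0 ∨ C13 = 1) ∧ (C22 = 0 ∨ C22 = 1) ∧ (C23 = 0 ∨ C23 = 1)

theorem FeasibleC.eq {C12 C13 C22 C23 : ℝ} (h : FeasibleC C12 C13 C22 C23) :
    C13 = 1 - C12 ∧ C22 = 1 - C12 ∧ C23 = C12 := by
  obtain ⟨-, -, -, -, h₁, h₂, h₃, h₄⟩ := h
  refine ⟨?_, ?_, ?_⟩ <;> linarith

/-- On the feasible segment, the cost is affine in the class-assignment variables. -/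
theorem g_eq_convex_combination (p N : ℕ) (x : Fin N → Fin p → ℝ) (I₁ I₂ : Finset (Fin N))
    (W12 W21 : ℝ) (F : ℝ → ℝ) (a : Fin p → ℝ) (μ c : ℝ) :
    g p N x I₁ I₂ W12 W21 F a μ c (1 - c) (1 - c) c =
      c * g p N x I₁ I₂ W12 W21 F a μ 1 0 0 1 +
        (1 - c) * g p N x I₁ I₂ W12 W21 F a μ 0 1 1 0 := by
  simp only [g, Finset.sum_add_distrib, ← Finset.sum_mul]
  ring

theorem continuous_g (p N : ℕ) (x : Fin N → Fin p → ℝ) (I₁ I₂ : Finset (Fin N))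
    (W12 W21 : ℝ) {F : ℝ → ℝ} (hF : Continuous F) (C12 C13 C22 C23 : ℝ) :
    Continuous fun q : (Fin p → ℝ) × ℝ =>
      g p N x I₁ I₂ W12 W21 F q.1 q.2 C12 C13 C22 C23 := by
  unfold g
  fun_prop

/-- Depth-1 two-class S-ORCT admits an optimal solution whose class-assignment
variables are all 0 or 1 (Theorem 1 instance). -/
theorem sorct_depth1_binary_optimal (p N : ℕ) (hp : 0 < p) (hN : 0 < N)
    (x : Fin N → Fin p → ℝ) (hx : ∀ i j, x i j ∈ Set.Icc (0 : ℝ) 1)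
    (I₁ I₂ : Finset (Fin N)) (hdisj : Disjoint I₁ I₂) (hunion : I₁ ∪ I₂ = Finset.univ)
    (W12 W21 : ℝ) (hW12 : 0 ≤ W12) (hW21 : 0 ≤ W21)
    (F : ℝ → ℝ) (hF : Continuous F) (lam : ℝ) (hlam : 0 ≤ lam) :
    ∃ (astar : Fin p → ℝ) (μstar : ℝ) (C12 C13 C22 C23 : ℝ),
      (∀ j, astar j ∈ Set.Icc (-1 : ℝ) 1) ∧ μstar ∈ Set.Icc (-1 : ℝ) 1 ∧
      FeasibleC C12 C13 C22 C23 ∧ BinaryC C12 C13 C22 C23 ∧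
      (∀ (a : Fin p → ℝ) (μ : ℝ) (C12' C13' C22' C23' : ℝ),
        (∀ j, a j ∈ Set.Icc (-1 : ℝ) 1) → μ ∈ Set.Icc (-1 : ℝ) 1 →
        FeasibleC C12' C13' C22' C23' →
        g p N x I₁ I₂ W12 W21 F astar μstar C12 C13 C22 C23 + lam * ∑ j, |astar j| ≤
          g p N x I₁ I₂ W12 W21 F a μ C12' C13' C22' C23' + lam * ∑ j, |a j|) := by
  let G₁ : (Fin p → ℝ) × ℝ → ℝ := fun q =>
    g p N x I₁ I₂ W12 W21 F q.1 q.2 1 0 0 1 + lam * ∑ j, |q.1 j|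
  let G₀ : (Fin p → ℝ) × ℝ → ℝ := fun q =>
    g p N x I₁ I₂ W12 W21 F q.1 q.2 0 1 1 0 + lam * ∑ j, |q.1 j|
  have hpen : Continuous fun q : (Fin p → ℝ) × ℝ => lam * ∑ j, |q.1 j| := by fun_prop
  have hG₁ : Continuous G₁ := (continuous_g p N x I₁ I₂ W12 W21 hF 1 0 0 1).add hpen
  have hG₀ : Continuous G₀ := (continuous_g p N x I₁ I₂ W12 W21 hF 0 1 1 0).add hpen
  let K : Set ((Fin p → ℝ) × ℝ) :=
    (Set.univ.pi fun _ => Set.Icc (-1 : ℝ) 1) ×ˢ Set.Icc (-1 : ℝ) 1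
  have hK : IsCompact K := (isCompact_univ_pi fun _ => isCompact_Icc).prod isCompact_Icc
  have hne : K.Nonempty := ⟨(0, 0), fun _ _ => by simp, by simp⟩
  obtain ⟨q, hq, hmin⟩ := hK.exists_isMinOn hne (hG₁.min hG₀).continuousOn
  have hlower : ∀ (a : Fin p → ℝ) (μ : ℝ) (C12 C13 C22 C23 : ℝ),
      (∀ j, a j ∈ Set.Icc (-1 : ℝ) 1) → μ ∈ Set.Icc (-1 : ℝ) 1 →
      FeasibleC C12 C13 C22 C23 →
      min (G₁ q) (G₀ q) ≤
        g p N x I₁ I₂ W12 W21 F a μ C12 C13 C22 C23 + lam * ∑ j, |a j| := by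
    intro a μ c C13 C22 C23 ha hμ hC
    have hm : min (G₁ q) (G₀ q) ≤ min (G₁ (a, μ)) (G₀ (a, μ)) :=
      hmin (show (a, μ) ∈ K from ⟨fun j _ => ha j, hμ⟩)
    have hc := hC.1
    obtain ⟨rfl, rfl, h⟩ := hC.eq
    rw [h, g_eq_convex_combination]
    have h₁ := mul_le_mul_of_nonneg_left (hm.trans (min_le_left _ _)) hc.1
    have h₀ := mul_le_mul_of_nonneg_left (hm.trans (min_le_right _ _)) (sub_nonneg.2 hc.2)
    simp only [G₁, G₀] at h₁ h₀ ⊢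
    linarith
  have ha : ∀ j, q.1 j ∈ Set.Icc (-1 : ℝ) 1 := fun j => hq.1 j (Set.mem_univ j)
  rcases le_total (G₁ q) (G₀ q) with h | h
  · rw [min_eq_left h] at hlower
    exact ⟨q.1, q.2, 1, 0, 0, 1, ha, hq.2, by norm_num [FeasibleC], by norm_num [BinaryC],
      hlower⟩
  · rw [min_eq_right h] at hlower
    exact ⟨q.1, q.2, 0, 1, 1, 0, ha, hq.2, by norm_num [FeasibleC], by norm_num [BinaryC],
      hlower⟩
end

section
/- Core of Theorem 2 (stationarity of the all-zero cut matrix): let p and T be positive integers, let v : Fin p → Fin T → ℝ (playing the role of the gradient ∇_a g(0, μ*, C*) row-indexed by predictor variables j and column-indexed by branch nodes t), let σ ∈ [0,1], and suppose λL ≥ (1 − σ)·max_{j} max_{t} |v j t| and λG ≥ σ·max_{j} ∑_{t} |v j t|. Then for every a : Fin p → Fin T → ℝ, −∑_{j}∑_{t} v j t * a j t ≤ λL·∑_{j}∑_{t} |a j t| + λG·∑_{j} max_{t} |a j t|. That is, −v is a subgradient at the zero matrix of the regularizer a ↦ λL·∑_j ‖a_{j·}‖₁ + λG·∑_j ‖a_{j·}‖_∞,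 which is exactly the stationarity condition satisfied by a = 0 in Theorem 2 of the paper. -/
open Finset

/-- Core of Theorem 2: under the stated bounds on the sparsity parameters,
`−v` is a subgradient at the zero matrix of the regularizer
`a ↦ λL·∑_j ‖a_{j·}‖₁ + λG·∑_j ‖a_{j·}‖_∞`, i.e. the all-zero cut matrix is a
stationary point of the S-ORCT. -/
theorem sorct_zero_stationary (p T : ℕ) (hp : 0 < p) (hT : 0 < T)
    (v : Fin p → Fin T → ℝ) (σ : ℝ) (hσ : σ ∈ Set.Icc (0 : ℝ) 1)
    (lamL lamG : ℝ)
    (hlamL : (1 - σ) *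
        Finset.univ.sup' ⟨(⟨0, hp⟩ : Fin p), Finset.mem_univ _⟩ (fun j =>
          Finset.univ.sup' ⟨(⟨0, hT⟩ : Fin T), Finset.mem_univ _⟩ (fun t => |v j t|)) ≤ lamL)
    (hlamG : σ *
        Finset.univ.sup' ⟨(⟨0, hp⟩ : Fin p), Finset.mem_univ _⟩ (fun j =>
          ∑ t, |v j t|) ≤ lamG) :
    ∀ a : Fin p → Fin T → ℝ,
      -∑ j, ∑ t, v j t * a j t ≤
        lamL * ∑ j, ∑ t, |a j t| +
          lamG * ∑ j, Finset.univ.sup' ⟨(⟨0, hT⟩ : Fin T), Finset.mem_univ _⟩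
            (fun t => |a j t|) := by
  intro a
  obtain ⟨hσ0, hσ1⟩ := hσ
  have hL (j : Fin p) (t : Fin T) : (1 - σ) * |v j t| ≤ lamL :=
    (mul_le_mul_of_nonneg_left
      ((le_sup' (fun t => |v j t|) (mem_univ t)).trans
        (le_sup' (fun j => univ.sup' ⟨(⟨0, hT⟩ : Fin T), mem_univ _⟩ fun t => |v j t|)
          (mem_univ j)))
      (sub_nonneg.2 hσ1)).trans hlamL
  have hG (j : Fin p) : σ * ∑ t, |v j t| ≤ lamG :=
    (mul_le_mul_of_nonneg_left (le_sup' (fun j => ∑ t, |v j t|) (mem_univ j)) hσ0).trans hlamG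
  rw [mul_sum, mul_sum, ← sum_add_distrib, ← sum_neg_distrib]
  refine sum_le_sum fun j _ => ?_
  set M := univ.sup' ⟨(⟨0, hT⟩ : Fin T), mem_univ _⟩ fun t => |a j t|
  have haM (t : Fin T) : |a j t| ≤ M := le_sup' (fun t => |a j t|) (mem_univ t)
  have hM0 : 0 ≤ M := (abs_nonneg _).trans (haM ⟨0, hT⟩)
  calc -∑ t, v j t * a j t
      ≤ ∑ t, (lamL * |a j t| + σ * |v j t| * M) := by
        rw [← sum_neg_distrib]
        refine sum_le_sum fun t _ => ?_
        have h₁ : -(v j t * a j t) ≤ |v j t| * |a j t| := by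
          rw [← abs_mul]
          exact neg_le_abs _
        have h₂ := mul_le_mul_of_nonneg_right (hL j t) (abs_nonneg (a j t))
        have h₃ := mul_le_mul_of_nonneg_left (haM t) (mul_nonneg hσ0 (abs_nonneg (v j t)))
        linarith
    _ = lamL * ∑ t, |a j t| + (σ * ∑ t, |v j t|) * M := by
        rw [sum_add_distrib, ← mul_sum, ← sum_mul, ← mul_sum]
    _ ≤ lamL * ∑ t, |a j t| + lamG * M := by
        gcongr
        exact hG j
end

section
/- Maximum gradient norm over binary feasible assignments (key computation in the proof of Theorem 3): assume the depth-1 two-class ORCT setup, fix μ ∈ ℝ and f : ℝ → ℝ with f(−μ) ≥ 0, and for j ∈ Fin p and an assignment C define d_j(C) = (1/(N·p))·f(−μ)·( W₁₂·(∑_{i∈I₁} x_{ij})·(C₂₂ − C₂₃) + W₂₁·(∑_{i∈I₂} x_{ij})·(C₁₂ − C₁₃) ). Then the maximum of max_j |d_j(C)| over all binary feasible C equals (1/(N·p))·f(−μ)·max_j | W₁₂·∑_{i∈I₁} x_{ij} − W₂₁·∑_{i∈I₂} x_{ij} |. -/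
open Finset

/-- Binary feasible class-assignment variables for two classes and two leaves. -/
def BinaryFeasibleC (C12 C13 C22 C23 : ℝ) : Prop :=
  (C12 = 0 ∨ C12 = 1) ∧ (C13 = 0 ∨ C13 = 1) ∧ (C22 = 0 ∨ C22 = 1) ∧ (C23 = 0 ∨ C23 = 1) ∧
  C12 + C22 = 1 ∧ C13 + C23 = 1 ∧ 1 ≤ C12 + C13 ∧ 1 ≤ C22 + C23

/-- Partial derivative of the expected misclassification cost with respect to
`a_j` at `a = 0`. -/
noncomputable def dcoef (p N : ℕ) (x : Fin N → Fin p → ℝ) (I₁ I₂ : Finset (Fin N))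
    (W12 W21 : ℝ) (f : ℝ → ℝ) (μ : ℝ) (j : Fin p) (C12 C13 C22 C23 : ℝ) : ℝ :=
  (1 / ((N : ℝ) * (p : ℝ))) * f (-μ) *
    (W12 * (∑ i ∈ I₁, x i j) * (C22 - C23) + W21 * (∑ i ∈ I₂, x i j) * (C12 - C13))

/-- A binary feasible assignment gives the two leaves different classes. -/
theorem BinaryFeasibleC.eq_or_eq {C12 C13 C22 C23 : ℝ} (h : BinaryFeasibleC C12 C13 C22 C23) :
    (C12 = 0 ∧ C13 = 1 ∧ C22 = 1 ∧ C23 = 0) ∨ (C12 = 1 ∧ C13 = 0 ∧ C22 = 0 ∧ C23 = 1) := by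
  obtain ⟨h12, h13, -, -, h₁, h₂, h₃, h₄⟩ := h
  rcases h12 with rfl | rfl
  · left
    refine ⟨rfl, ?_, ?_, ?_⟩ <;> linarith
  · right
    refine ⟨rfl, ?_, ?_, ?_⟩ <;> linarith

theorem abs_dcoef_of_binaryFeasible {p N : ℕ} (x : Fin N → Fin p → ℝ) (I₁ I₂ : Finset (Fin N))
    (W12 W21 : ℝ) {f : ℝ → ℝ} {μ : ℝ} (hf : 0 ≤ f (-μ)) (j : Fin p) {C12 C13 C22 C23 : ℝ}
    (hC : BinaryFeasibleC C12 C13 C22 C23) :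
    |dcoef p N x I₁ I₂ W12 W21 f μ j C12 C13 C22 C23| =
      (1 / ((N : ℝ) * (p : ℝ))) * f (-μ) *
        |W12 * (∑ i ∈ I₁, x i j) - W21 * (∑ i ∈ I₂, x i j)| := by
  have hc : 0 ≤ (1 / ((N : ℝ) * (p : ℝ))) * f (-μ) := by positivity
  rw [dcoef, abs_mul, abs_of_nonneg hc]
  congr 1
  obtain ⟨rfl, rfl, rfl, rfl⟩ | ⟨rfl, rfl, rfl, rfl⟩ := hC.eq_or_eq
  · congr 1
    ring
  · rw [← abs_neg]
    congr 1
    ring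

/-- Key computation in the proof of Theorem 3: the maximum of `max_j |d_j(C)|`
over all binary feasible assignments `C` equals
`(1/(N·p))·f(−μ)·max_j |W₁₂·∑_{i∈I₁} x_{ij} − W₂₁·∑_{i∈I₂} x_{ij}|`. -/
theorem max_gradient_over_binary_feasible (p N : ℕ) (hp : 0 < p) (hN : 0 < N)
    (x : Fin N → Fin p → ℝ) (hx : ∀ i j, x i j ∈ Set.Icc (0 : ℝ) 1)
    (I₁ I₂ : Finset (Fin N)) (hdisj : Disjoint I₁ I₂) (hunion : I₁ ∪ I₂ = Finset.univ)
    (W12 W21 : ℝ) (hW12 : 0 ≤ W12) (hW21 : 0 ≤ W21)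
    (μ : ℝ) (f : ℝ → ℝ) (hf : 0 ≤ f (-μ)) :
    IsGreatest
      { r : ℝ | ∃ C12 C13 C22 C23 : ℝ, BinaryFeasibleC C12 C13 C22 C23 ∧
          r = Finset.univ.sup' ⟨(⟨0, hp⟩ : Fin p), Finset.mem_univ _⟩
            (fun j => |dcoef p N x I₁ I₂ W12 W21 f μ j C12 C13 C22 C23|) }
      ((1 / ((N : ℝ) * (p : ℝ))) * f (-μ) *
        Finset.univ.sup' ⟨(⟨0, hp⟩ : Fin p), Finset.mem_univ _⟩
          (fun j => |W12 * (∑ i ∈ I₁, x i j) - W21 * (∑ i ∈ I₂, x i j)|)) := by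
  have hc : 0 ≤ (1 / ((N : ℝ) * (p : ℝ))) * f (-μ) := by positivity
  have hsup : ∀ C12 C13 C22 C23 : ℝ, BinaryFeasibleC C12 C13 C22 C23 →
      Finset.univ.sup' ⟨(⟨0, hp⟩ : Fin p), Finset.mem_univ _⟩
          (fun j => |dcoef p N x I₁ I₂ W12 W21 f μ j C12 C13 C22 C23|) =
        (1 / ((N : ℝ) * (p : ℝ))) * f (-μ) *
          Finset.univ.sup' ⟨(⟨0, hp⟩ : Fin p), Finset.mem_univ _⟩
            (fun j => |W12 * (∑ i ∈ I₁, x i j) - W21 * (∑ i ∈ I₂, x i j)|) := by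
    intro C12 C13 C22 C23 hC
    exact (Finset.sup'_congr _ rfl fun j _ =>
      abs_dcoef_of_binaryFeasible x I₁ I₂ W12 W21 hf j hC).trans (Finset.mul₀_sup' hc _ _ _).symm
  constructor
  · have hC : BinaryFeasibleC 0 1 1 0 := by norm_num [BinaryFeasibleC]
    exact ⟨0, 1, 1, 0, hC, (hsup _ _ _ _ hC).symm⟩
  · rintro r ⟨C12, C13, C22, C23, hC, rfl⟩
    exact (hsup _ _ _ _ hC).le
end

section
/- Theorem 3 (stationarity of a = 0 for the depth-1 S-ORCT): assume the depth-1 two-class ORCT setup, let f : ℝ → ℝ be nonnegative and such that F has derivative f at every point, and suppose λ ≥ (1/N)·( max_j | W₁₂·∑_{i∈I₁} x_{ij} − W₂₁·∑_{i∈I₂} x_{ij} | )·max( f(−1), f(1) ). Then for every μ ∈ {−1, 1} and every binary feasible C, the vector v : Fin p → ℝ of partial derivatives v_j = derivative at s = 0 of s ↦ g(s·e_j, μ, C) satisfies |v_j| ≤ λ for all j; consequently, for every a : Fin p → ℝ, −∑_j v_j·a_j ≤ λ·∑_j |a_j|, i.e., −v is a subgradient at 0 of the regularizer a ↦ λ‖a‖₁,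 so a = 0 is a stationary point of the depth-1 S-ORCT. -/
open Finset

/-- Partial derivative of `g` at `a = 0`, as a function of the two leaf contrasts. -/
theorem hasDerivAt_g_single (p N : ℕ) (x : Fin N → Fin p → ℝ) (I₁ I₂ : Finset (Fin N))
    (W12 W21 : ℝ) {F : ℝ → ℝ} {d μ : ℝ} (hF : HasDerivAt F d (-μ))
    (C12 C13 C22 C23 : ℝ) (j : Fin p) :
    HasDerivAt
      (fun s : ℝ => g p N x I₁ I₂ W12 W21 F (Pi.single j s) μ C12 C13 C22 C23)
      ((1 / (N : ℝ)) * ((1 / (p : ℝ)) * d *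
        ((C22 - C23) * (W12 * ∑ i ∈ I₁, x i j) + (C12 - C13) * (W21 * ∑ i ∈ I₂, x i j)))) 0 := by
  have hterm (i : Fin N) : HasDerivAt (fun s : ℝ => F ((1 / (p : ℝ)) * (s * x i j) - μ))
      (d * ((1 / (p : ℝ)) * x i j)) 0 := by
    have hlin : HasDerivAt (fun s : ℝ => (1 / (p : ℝ)) * (s * x i j) - μ)
        ((1 / (p : ℝ)) * (1 * x i j)) 0 :=
      (((hasDerivAt_id (0 : ℝ)).mul_const (x i j)).const_mul (1 / (p : ℝ))).sub_const μ
    rw [one_mul] at hlin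
    exact HasDerivAt.comp (0 : ℝ) (by simpa using hF) hlin
  have hcost (W A B : ℝ) (I : Finset (Fin N)) :
      HasDerivAt (fun s : ℝ => ∑ i ∈ I, (F ((1 / (p : ℝ)) * (s * x i j) - μ) * W * A
        + (1 - F ((1 / (p : ℝ)) * (s * x i j) - μ)) * W * B))
        (∑ i ∈ I, (d * ((1 / (p : ℝ)) * x i j) * W * A
          + -(d * ((1 / (p : ℝ)) * x i j)) * W * B)) 0 :=
    HasDerivAt.fun_sum fun i _ =>
      (((hterm i).mul_const W).mul_const A).add
        ((((hterm i).const_sub 1).mul_const W).mul_const B)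
  have hsum (s : ℝ) (i : Fin N) : ∑ k, (Pi.single j s : Fin p → ℝ) k * x i k = s * x i j := by
    simp [Pi.single_apply]
  simp only [g, hsum]
  refine (((hcost W12 C22 C23 I₁).add (hcost W21 C12 C13 I₂)).const_mul (1 / (N : ℝ))).congr_deriv ?_
  simp only [Finset.mul_sum, mul_add]
  congr 1 <;> exact Finset.sum_congr rfl fun i _ => by ring

/-- Each class is assigned to exactly one of the two leaves, so the leaf contrasts of the two
classes are opposite signs. -/
theorem BinaryFeasibleC.contrast {C12 C13 C22 C23 : ℝ} (h : BinaryFeasibleC C12 C13 C22 C23) :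
    |C22 - C23| = 1 ∧ C12 - C13 = -(C22 - C23) := by
  obtain ⟨h12, -, -, -, h2, h3, h1, h4⟩ := h
  refine ⟨?_, by linarith⟩
  rcases h12 with h12 | h12
  · rw [show C22 - C23 = 1 by linarith, abs_one]
  · rw [show C22 - C23 = -1 by linarith, abs_neg, abs_one]

/-- A vector with `ℓ∞`-norm at most `c` is a subgradient at `0` of `c` times the `ℓ¹`-norm. -/
theorem neg_sum_mul_le_of_abs_le {ι : Type*} [Fintype ι] {v : ι → ℝ} {c : ℝ}
    (hv : ∀ j, |v j| ≤ c) (a : ι → ℝ) : -∑ j, v j * a j ≤ c * ∑ j, |a j| := by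
  rw [Finset.mul_sum, ← Finset.sum_neg_distrib]
  refine Finset.sum_le_sum fun j _ => (neg_le_abs _).trans ?_
  rw [abs_mul]
  exact mul_le_mul_of_nonneg_right (hv j) (abs_nonneg _)

/-- Theorem 3: for λ above the stated bound, the gradient of `g` with respect
to `a` at `a = 0` is bounded by `λ` in the ℓ∞-norm for every `μ ∈ {−1,1}` and
every binary feasible `C`; consequently `−∇_a g(0,μ,C)` is a subgradient at 0
of `a ↦ λ‖a‖₁`, i.e., `a = 0` is a stationary point of the depth-1 S-ORCT. -/
theorem sorct_depth1_zero_stationary (p N : ℕ) (hp : 0 < p) (hN : 0 < N)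
    (x : Fin N → Fin p → ℝ) (hx : ∀ i j, x i j ∈ Set.Icc (0 : ℝ) 1)
    (I₁ I₂ : Finset (Fin N)) (hdisj : Disjoint I₁ I₂) (hunion : I₁ ∪ I₂ = Finset.univ)
    (W12 W21 : ℝ) (hW12 : 0 ≤ W12) (hW21 : 0 ≤ W21)
    (F f : ℝ → ℝ) (hf : ∀ t : ℝ, 0 ≤ f t) (hF : ∀ t : ℝ, HasDerivAt F (f t) t)
    (lam : ℝ)
    (hlam : (1 / (N : ℝ)) *
        (Finset.univ.sup' ⟨(⟨0, hp⟩ : Fin p), Finset.mem_univ _⟩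
          (fun j => |W12 * (∑ i ∈ I₁, x i j) - W21 * (∑ i ∈ I₂, x i j)|)) *
          max (f (-1)) (f 1) ≤ lam) :
    ∀ μ ∈ ({-1, 1} : Set ℝ), ∀ C12 C13 C22 C23 : ℝ,
      BinaryFeasibleC C12 C13 C22 C23 →
      ∀ v : Fin p → ℝ,
        (∀ j, HasDerivAt
          (fun s : ℝ => g p N x I₁ I₂ W12 W21 F (Pi.single j s) μ C12 C13 C22 C23)
          (v j) 0) →
        (∀ j, |v j| ≤ lam) ∧
        (∀ a : Fin p → ℝ, -∑ j, v j * a j ≤ lam * ∑ j, |a j|) := by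
  intro μ hμ C12 C13 C22 C23 hC v hv
  suffices hbound : ∀ j, |v j| ≤ lam from ⟨hbound, neg_sum_mul_le_of_abs_le hbound⟩
  intro j
  obtain ⟨hone, hopp⟩ := hC.contrast
  have hfμ : f (-μ) ≤ max (f (-1)) (f 1) := by
    rcases hμ with rfl | rfl
    · simp
    · exact le_max_left _ _
  have hp1 : 1 / (p : ℝ) ≤ 1 := by
    rw [one_div]
    exact Nat.cast_inv_le_one p
  rw [(hv j).unique (hasDerivAt_g_single p N x I₁ I₂ W12 W21 (hF (-μ)) C12 C13 C22 C23 j), hopp]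
  refine le_trans ?_ hlam
  set D : Fin p → ℝ := fun j => |W12 * (∑ i ∈ I₁, x i j) - W21 * (∑ i ∈ I₂, x i j)|
  have hDj : D j ≤ Finset.univ.sup' ⟨(⟨0, hp⟩ : Fin p), Finset.mem_univ _⟩ D :=
    Finset.le_sup' D (Finset.mem_univ j)
  have hD0 : 0 ≤ D j := abs_nonneg _
  calc _ = 1 / (N : ℝ) * (D j * ((1 / (p : ℝ)) * f (-μ))) := by
        rw [show (C22 - C23) * (W12 * ∑ i ∈ I₁, x i j) + -(C22 - C23) * (W21 * ∑ i ∈ I₂, x i j)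
          = (C22 - C23) * (W12 * ∑ i ∈ I₁, x i j - W21 * ∑ i ∈ I₂, x i j) by ring]
        rw [abs_mul, abs_mul, abs_mul, abs_mul, hone, abs_of_nonneg (hf _),
          abs_of_nonneg (by positivity : (0 : ℝ) ≤ 1 / N),
          abs_of_nonneg (by positivity : (0 : ℝ) ≤ 1 / p)]
        ring
    _ ≤ 1 / (N : ℝ) * (Finset.univ.sup' ⟨(⟨0, hp⟩ : Fin p), Finset.mem_univ _⟩ D *
          max (f (-1)) (f 1)) := by
        refine mul_le_mul_of_nonneg_left ?_ (by positivity)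
        exact mul_le_mul hDj ((mul_le_of_le_one_left (hf _) hp1).trans hfμ)
          (mul_nonneg (by positivity) (hf _)) (hD0.trans hDj)
    _ = _ := (mul_assoc _ _ _).symm
end
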